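/- In the C*-setting, suppose in addition that the joint law τ of a is faithful on ℂ⟨X⟩ (τ(f⋆f) = 0 implies f = 0), let (P_w)_{w∈⟨X⟩_d} be a family of orthonormal polynomials of τ at degree d, let k ≥ 1, and suppose M_d ∈ [1,∞) satisfies the degree-d Bernstein–Markov inequality: ‖P(a)‖ ≤ M_d · ( (tr_k⊗tr)(P(a)^* P(a)) )^{1/2} for every P ∈ M_k(ℂ⟨X⟩_d), where tr_k⊗tr denotes the normalized trace on M_k(𝒜) (the average over the diagonal of the entrywise traces). Then for every tuple A of hermitian k×k complex matrices: ‖κ_{τ,d}(A,A)(I_k)‖ ≤ M_d² · Φ^∞_{a,d}(A) and tr_k(κ_{τ,d}(A,A)(I_k)) ≤ M_d² · Φ²_{a,d}(A). -/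

import Mathlib

open scoped ComplexOrder Matrix

namespace NCCD

/-- Words in the letters `X_1, …, X_n`, i.e. elements of the free monoid on `n` generators. -/
abbrev Word (n : ℕ) : Type := FreeMonoid (Fin n)

/-- The free unital `*`-algebra `ℂ⟨X_1, …, X_n⟩`, modeled as the monoid algebra of the
free monoid on `n` generators. -/
abbrev NCPoly (n : ℕ) : Type := MonoidAlgebra ℂ (Word n)

/-- The monomial associated to a word. -/
noncomputable def mono {n : ℕ} (w : Word n) : NCPoly n :=
  MonoidAlgebra.of ℂ (Word n) w

/-- The length of a word. -/
def wlen {n : ℕ} (w : Word n) : ℕ := (FreeMonoid.toList w).length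

/-- The involution `⋆` on `ℂ⟨X⟩`: conjugate the coefficients and reverse the words. -/
noncomputable def ncStar {n : ℕ} (f : NCPoly n) : NCPoly n :=
  MonoidAlgebra.ofCoeff (Finsupp.mapDomain (fun w => FreeMonoid.ofList (FreeMonoid.toList w).reverse)
    (Finsupp.mapRange (starRingEnd ℂ) (map_zero _) f.coeff))

/-- `τ` is a positive functional: `τ(f⋆ f) ≥ 0` for all `f`. -/
def IsPositive {n : ℕ} (τ : NCPoly n →ₗ[ℂ] ℂ) : Prop :=
  ∀ f : NCPoly n, 0 ≤ τ (ncStar f * f)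

/-- `τ` is tracial: `τ(fg) = τ(gf)`. -/
def IsTracial {n : ℕ} (τ : NCPoly n →ₗ[ℂ] ℂ) : Prop :=
  ∀ f g : NCPoly n, τ (f * g) = τ (g * f)

/-- `τ` is faithful: `τ(f⋆ f) = 0` implies `f = 0`. -/
def IsFaithful {n : ℕ} (τ : NCPoly n →ₗ[ℂ] ℂ) : Prop :=
  ∀ f : NCPoly n, τ (ncStar f * f) = 0 → f = 0

/-- The strict graded lexicographic order on words. -/
def glLt {n : ℕ} (v w : Word n) : Prop :=
  wlen v < wlen w ∨
    (wlen v = wlen w ∧ List.Lex (· < ·) (FreeMonoid.toList v) (FreeMonoid.toList w))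

/-- The graded lexicographic order on words. -/
def glLe {n : ℕ} (v w : Word n) : Prop := glLt v w ∨ v = w

/-- Words of length at most `d`. -/
abbrev WordLE (n d : ℕ) : Type := {w : Word n // wlen w ≤ d}

instance {n : ℕ} : DecidableEq (Word n) := fun a b =>
  decidable_of_iff (FreeMonoid.toList a = FreeMonoid.toList b)
    ⟨fun h => FreeMonoid.toList.injective h, fun h => by rw [h]⟩

instance (n d : ℕ) : Finite (WordLE n d) := by
  apply Finite.of_surjective
    (f := fun p : (k : Fin (d+1)) × (Fin k → Fin n) =>
      (⟨FreeMonoid.ofList (List.ofFn p.2), by simp [wlen]; omega⟩ : WordLE n d))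
  rintro ⟨w, hw⟩
  refine ⟨⟨⟨wlen w, by omega⟩, fun i => (FreeMonoid.toList w).get ⟨i, i.2⟩⟩, ?_⟩
  apply Subtype.ext
  simp [wlen, List.ofFn_get]

noncomputable instance (n d : ℕ) : Fintype (WordLE n d) := Fintype.ofFinite _

/-- The span `ℂ⟨X⟩_d` of the monomials of degree at most `d`. -/
noncomputable def degLE (n d : ℕ) : Submodule ℂ (NCPoly n) :=
  Submodule.span ℂ {p : NCPoly n | ∃ w : Word n, wlen w ≤ d ∧ p = mono w}

end NCCD

namespace NCCD

/-- Evaluation `A^w` of a word at a tuple of matrices. -/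
noncomputable def wordEvalM {n k : ℕ} (A : Fin n → Matrix (Fin k) (Fin k) ℂ) (w : Word n) :
    Matrix (Fin k) (Fin k) ℂ :=
  ((FreeMonoid.toList w).map A).prod

/-- Evaluation `f(A)` of a noncommutative polynomial at a tuple of matrices. -/
noncomputable def polyEvalM {n k : ℕ} (A : Fin n → Matrix (Fin k) (Fin k) ℂ) (f : NCPoly n) :
    Matrix (Fin k) (Fin k) ℂ :=
  Finsupp.sum f.coeff fun w c => c • wordEvalM A w

/-- `P(A)(I_k)` for the matrix noncommutative polynomial `P = Σ_i a_i ⊗ q_i`. -/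
noncomputable def evalId {n k : ℕ} {ι : Type*} [Fintype ι]
    (A : Fin n → Matrix (Fin k) (Fin k) ℂ) (a : ι → Matrix (Fin k) (Fin k) ℂ)
    (q : ι → NCPoly n) : Matrix (Fin k) (Fin k) ℂ :=
  ∑ i, a i * polyEvalM A (q i)

/-- `(Id ⊗ τ)(P P⋆)` for the matrix noncommutative polynomial `P = Σ_i a_i ⊗ q_i`. -/
noncomputable def idTensorTau {n k : ℕ} {ι : Type*} [Fintype ι] (τ : NCPoly n →ₗ[ℂ] ℂ)
    (a : ι → Matrix (Fin k) (Fin k) ℂ) (q : ι → NCPoly n) : Matrix (Fin k) (Fin k) ℂ :=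
  ∑ i, ∑ j, τ (q i * ncStar (q j)) • (a i * (a j)ᴴ)

/-- The Christoffel–Darboux kernel evaluation
`κ_{τ,d}(A,A)(I_k) = Σ_w P_w(A) ⬝ (P_w⋆)(A)`. -/
noncomputable def cdKernel {n k : ℕ} (d : ℕ) (P : Word n → NCPoly n)
    (A : Fin n → Matrix (Fin k) (Fin k) ℂ) : Matrix (Fin k) (Fin k) ℂ :=
  ∑ w : WordLE n d, polyEvalM A (P w.1) * polyEvalM A (ncStar (P w.1))

end NCCD

namespace NCCD

/-- A family of orthonormal polynomials of a faithful positive tracial state `τ` at degree `d`: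
a family `(P_w)` in `ℂ⟨X⟩_d` with `P_1 = 1`, `τ(P_v⋆ P_w) = δ_{v,w}`, `τ(P_v⋆ w) = 0` whenever
`w <_gl v`, and `τ(P_w⋆ w) > 0`, for all words `v, w` of length at most `d`. -/
def IsONB {n : ℕ} (τ : NCPoly n →ₗ[ℂ] ℂ) (d : ℕ) (P : Word n → NCPoly n) : Prop :=
  (∀ w : Word n, wlen w ≤ d → P w ∈ degLE n d) ∧
  P 1 = 1 ∧
  (∀ v w : Word n, wlen v ≤ d → wlen w ≤ d →
    τ (ncStar (P v) * P w) = if v = w then 1 else 0) ∧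
  (∀ v w : Word n, wlen v ≤ d → wlen w ≤ d → glLt w v → τ (ncStar (P v) * mono w) = 0) ∧
  (∀ w : Word n, wlen w ≤ d → 0 < τ (ncStar (P w) * mono w))

end NCCD

open scoped Matrix.Norms.L2Operator

namespace NCCD

section CStar

variable {𝒜 : Type*} [NormedRing 𝒜] [StarRing 𝒜] [CStarRing 𝒜] [CompleteSpace 𝒜]
  [NormedAlgebra ℂ 𝒜] [StarModule ℂ 𝒜]

/-- `tr` is a tracial state on the unital C*-algebra `𝒜`: a positive linear functional with
`tr 1 = 1` and `tr (xy) = tr (yx)`. -/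
def IsTracialStateA (tr : 𝒜 →ₗ[ℂ] ℂ) : Prop :=
  tr 1 = 1 ∧ (∀ x : 𝒜, 0 ≤ tr (star x * x)) ∧ (∀ x y : 𝒜, tr (x * y) = tr (y * x))

/-- `tr` is faithful: `tr (x⋆x) = 0` implies `x = 0`. -/
def IsFaithfulA (tr : 𝒜 →ₗ[ℂ] ℂ) : Prop :=
  ∀ x : 𝒜, tr (star x * x) = 0 → x = 0

/-- Evaluation `a^w` of a word at a tuple of elements of `𝒜`. -/
def wordEvalA {N : ℕ} (a : Fin N → 𝒜) (w : Word N) : 𝒜 :=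
  ((FreeMonoid.toList w).map a).prod

/-- Evaluation `f(a)` of a scalar noncommutative polynomial at a tuple of elements of `𝒜`. -/
noncomputable def polyEvalA {N : ℕ} (a : Fin N → 𝒜) (f : NCPoly N) : 𝒜 :=
  Finsupp.sum f.coeff fun w z => z • wordEvalA a w

/-- Evaluation `P(a) = Σ_w c_w ⊗ a^w ∈ M_k(𝒜)` of the matrix noncommutative polynomial with
coefficients `e : ⟨X⟩_d → M_k(ℂ)`. -/
noncomputable def matPolyEvalA {N d k : ℕ} (a : Fin N → 𝒜)
    (e : WordLE N d → Matrix (Fin k) (Fin k) ℂ) : Matrix (Fin k) (Fin k) 𝒜 :=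
  ∑ w : WordLE N d, (e w).map (fun z => z • wordEvalA a w.1)

/-- `P(A)(I_k) = Σ_w c_w A^w` for the matrix noncommutative polynomial with coefficients
`e : ⟨X⟩_d → M_k(ℂ)`. -/
noncomputable def matPolyEvalM {N d k : ℕ} (A : Fin N → Matrix (Fin k) (Fin k) ℂ)
    (e : WordLE N d → Matrix (Fin k) (Fin k) ℂ) : Matrix (Fin k) (Fin k) ℂ :=
  ∑ w : WordLE N d, e w * wordEvalM A w.1

/-- The statement `‖P‖² ≤ c` for `P ∈ M_k(𝒜)`, `𝒜` a unital C*-algebra. It is encoded --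
equivalently, since `M_k(𝒜)` is again a unital C*-algebra, in which an element is positive if
and only if it is of the form `Q⋆Q`, and `‖P‖² ≤ c` if and only if `c·1 - P⋆P` is positive --
by the existence of `Q ∈ M_k(𝒜)` with `c·1 - Pᴴ P = Qᴴ Q`. -/
def cstarNormSqLE {k : ℕ} (P : Matrix (Fin k) (Fin k) 𝒜) (c : ℝ) : Prop :=
  ∃ Q : Matrix (Fin k) (Fin k) 𝒜, (c : ℂ) • (1 : Matrix (Fin k) (Fin k) 𝒜) - Pᴴ * P = Qᴴ * Q

/-- The degree-`d` noncommutative Siciak function `Φ²_{a,d}`: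
`Φ²_{a,d}(A) = sup { tr_k(P(A)(I_k)† P(A)(I_k)) : P ∈ M_k(ℂ⟨X⟩_d), ‖P(a)‖ ≤ 1 }`. -/
noncomputable def Phi2 {N : ℕ} (a : Fin N → 𝒜) (d k : ℕ)
    (A : Fin N → Matrix (Fin k) (Fin k) ℂ) : ℝ :=
  sSup { t : ℝ | ∃ e : WordLE N d → Matrix (Fin k) (Fin k) ℂ,
    cstarNormSqLE (matPolyEvalA a e) 1 ∧
    t = (Matrix.trace ((matPolyEvalM A e)ᴴ * matPolyEvalM A e)).re / k }

/-- The degree-`d` noncommutative Siciak function `Φ^∞_{a,d}`: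
`Φ^∞_{a,d}(A) = sup { ‖P(A)(I_k)‖² : P ∈ M_k(ℂ⟨X⟩_d), ‖P(a)‖ ≤ 1 }`, the norm on `M_k(ℂ)`
being the operator (C*) norm. -/
noncomputable def PhiInf {N : ℕ} (a : Fin N → 𝒜) (d k : ℕ)
    (A : Fin N → Matrix (Fin k) (Fin k) ℂ) : ℝ :=
  sSup { t : ℝ | ∃ e : WordLE N d → Matrix (Fin k) (Fin k) ℂ,
    cstarNormSqLE (matPolyEvalA a e) 1 ∧ t = ‖matPolyEvalM A e‖ ^ 2 }

end CStar

end NCCD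

namespace NCCD

section Helpers

/-- The reversal of a word. -/
def wrev {n : ℕ} (w : Word n) : Word n := FreeMonoid.ofList (FreeMonoid.toList w).reverse

theorem ncStar_add {n : ℕ} (f g : NCPoly n) : ncStar (f + g) = ncStar f + ncStar g := by
  unfold ncStar
  rw [MonoidAlgebra.coeff_add, Finsupp.mapRange_add (by simp), Finsupp.mapDomain_add]
  rfl

theorem ncStar_single {n : ℕ} (w : Word n) (c : ℂ) :
    ncStar (MonoidAlgebra.single w c) = MonoidAlgebra.single (wrev w) (starRingEnd ℂ c) := by
  unfold ncStar
  rw [MonoidAlgebra.coeff_single, Finsupp.mapRange_single, Finsupp.mapDomain_single]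
  rfl

theorem ncStar_zero {n : ℕ} : ncStar (0 : NCPoly n) = 0 := by
  unfold ncStar
  rw [MonoidAlgebra.coeff_zero, Finsupp.mapRange_zero, Finsupp.mapDomain_zero]
  rfl

/-- Generic evaluation homomorphism. -/
noncomputable def gEval {B : Type*} [Ring B] [Algebra ℂ B] {n : ℕ} (b : Fin n → B) :
    NCPoly n →ₐ[ℂ] B := MonoidAlgebra.lift ℂ B (Word n) (FreeMonoid.lift b)

theorem gEval_single {B : Type*} [Ring B] [Algebra ℂ B] {n : ℕ} (b : Fin n → B) (w : Word n)
    (c : ℂ) : gEval b (MonoidAlgebra.single w c) = c • ((FreeMonoid.toList w).map b).prod := by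
  unfold gEval
  rw [MonoidAlgebra.lift_single, FreeMonoid.lift_apply]

theorem gEval_mono {B : Type*} [Ring B] [Algebra ℂ B] {n : ℕ} (b : Fin n → B) (w : Word n) :
    gEval b (mono w) = ((FreeMonoid.toList w).map b).prod := by
  have := gEval_single b w 1
  rw [one_smul] at this
  exact this

theorem nc_induction {n : ℕ} {p : NCPoly n → Prop} (f : NCPoly n) (h0 : p 0)
    (hadd : ∀ f g, p f → p g → p (f + g)) (hs : ∀ w c, p (MonoidAlgebra.single w c)) : p f := by
  obtain ⟨f⟩ := f
  induction f using Finsupp.induction_linear with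
  | zero => exact h0
  | add f g hf hg => exact hadd _ _ hf hg
  | single w c => exact hs w c

theorem gEval_ncStar {B : Type*} [Ring B] [StarRing B] [Algebra ℂ B] [StarModule ℂ B] {n : ℕ}
    (b : Fin n → B) (hb : ∀ i, star (b i) = b i) (f : NCPoly n) :
    gEval b (ncStar f) = star (gEval b f) := by
  induction f using nc_induction with
  | h0 => simp [ncStar_zero]
  | hadd f g hf hg => rw [ncStar_add, map_add, map_add, star_add, hf, hg]
  | hs w c =>
    rw [ncStar_single, gEval_single, gEval_single, star_smul]
    congr 1
    unfold wrev
    rw [FreeMonoid.toList_ofList]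
    generalize FreeMonoid.toList w = l
    induction l with
    | nil => simp
    | cons x l ih =>
      simp only [List.reverse_cons, List.map_append, List.prod_append, ih]
      simp [hb]

theorem polyEvalM_eq {n k : ℕ} (A : Fin n → Matrix (Fin k) (Fin k) ℂ) (f : NCPoly n) :
    polyEvalM A f = gEval A f := by
  unfold gEval polyEvalM
  rw [MonoidAlgebra.lift_apply]
  simp only [FreeMonoid.lift_apply]
  rfl

theorem polyEvalA_eq {𝒜 : Type*} [NormedRing 𝒜] [NormedAlgebra ℂ 𝒜] {n : ℕ} (a : Fin n → 𝒜)
    (f : NCPoly n) : polyEvalA a f = gEval a f := by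
  unfold gEval polyEvalA
  rw [MonoidAlgebra.lift_apply]
  simp only [FreeMonoid.lift_apply]
  rfl

theorem single_eq_smul_mono {n : ℕ} (w : Word n) (c : ℂ) :
    (MonoidAlgebra.single w c : NCPoly n) = c • mono w := by
  unfold mono
  simp

theorem ncStar_smul {n : ℕ} (c : ℂ) (f : NCPoly n) :
    ncStar (c • f) = starRingEnd ℂ c • ncStar f := by
  induction f using nc_induction with
  | h0 => simp [ncStar_zero]
  | hadd f g hf hg => rw [smul_add, ncStar_add, ncStar_add, smul_add, hf, hg]
  | hs w x => simp [ncStar_single]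

theorem ncStar_mem_degLE {n d : ℕ} {f : NCPoly n} (hf : f ∈ degLE n d) :
    ncStar f ∈ degLE n d := by
  unfold degLE at hf
  induction hf using Submodule.span_induction with
  | mem x h =>
    obtain ⟨w, hw, rfl⟩ := h
    have h1 := single_eq_smul_mono w 1
    rw [one_smul] at h1
    rw [← h1, ncStar_single, single_eq_smul_mono]
    refine Submodule.smul_mem _ _ (Submodule.subset_span ⟨wrev w, ?_, rfl⟩)
    simpa [wrev, wlen] using hw
  | zero => rw [ncStar_zero]; exact Submodule.zero_mem _
  | add x y _ _ hx hy => rw [ncStar_add]; exact Submodule.add_mem _ hx hy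
  | smul c x _ hx => rw [ncStar_smul]; exact Submodule.smul_mem _ _ hx

theorem degLE_expand {n d : ℕ} {f : NCPoly n} (hf : f ∈ degLE n d) :
    f = ∑ w : WordLE n d, f.coeff w.1 • mono w.1 := by
  unfold degLE at hf
  induction hf using Submodule.span_induction with
  | mem x h =>
    obtain ⟨w, hw, rfl⟩ := h
    rw [Finset.sum_eq_single (⟨w, hw⟩ : WordLE n d)]
    · simp [mono]
    · intro b _ hb
      have : b.1 ≠ w := fun h => hb (Subtype.ext h)
      simp [mono, Finsupp.single_apply, this.symm]
    · simp
  | zero => simp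
  | add x y _ _ hx hy =>
    simp only [MonoidAlgebra.coeff_add, Finsupp.add_apply, add_smul, Finset.sum_add_distrib]
    rw [← hx, ← hy]
  | smul c x _ hx =>
    simp only [MonoidAlgebra.coeff_smul, Finsupp.smul_apply, smul_assoc, ← Finset.smul_sum]
    rw [← hx]

theorem gEval_expand {B : Type*} [Ring B] [Algebra ℂ B] {n d : ℕ} (b : Fin n → B)
    {f : NCPoly n} (hf : f ∈ degLE n d) :
    gEval b f = ∑ w : WordLE n d, f.coeff w.1 • ((FreeMonoid.toList w.1).map b).prod := by
  conv_lhs => rw [degLE_expand hf]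
  simp [map_sum, gEval_mono]

theorem cstarNormSqLE_smul {𝒜 : Type*} [NormedRing 𝒜] [StarRing 𝒜]
    [CStarRing 𝒜] [CompleteSpace 𝒜] [NormedAlgebra ℂ 𝒜] [StarModule ℂ 𝒜] {k : ℕ}
    (X : Matrix (Fin k) (Fin k) 𝒜) (c t : ℝ) (h : cstarNormSqLE X c) :
    cstarNormSqLE ((t : ℂ) • X) (t ^ 2 * c) := by
  obtain ⟨Q, hQ⟩ := h
  refine ⟨(t : ℂ) • Q, ?_⟩
  simp only [Matrix.conjTranspose_smul, Matrix.smul_mul, Matrix.mul_smul, ← hQ, smul_sub,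
    smul_smul]
  simp
  ring_nf

theorem entry_norm_le_l2 {k : ℕ} (X : Matrix (Fin k) (Fin k) ℂ) (i j : Fin k) :
    ‖X i j‖ ≤ ‖X‖ := by
  have h := Matrix.l2_opNorm_mulVec X (EuclideanSpace.single j 1)
  rw [EuclideanSpace.norm_single, norm_one, mul_one] at h
  refine le_trans ?_ h
  refine le_trans ?_ (PiLp.norm_apply_le _ i)
  simp

theorem trace_conj_mul_re {k : ℕ} (X : Matrix (Fin k) (Fin k) ℂ) :
    (Matrix.trace (Xᴴ * X)).re = ∑ j, ∑ i, ‖X i j‖ ^ 2 := by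
  simp only [Matrix.trace, Matrix.diag, Matrix.mul_apply, Matrix.conjTranspose_apply,
    Complex.re_sum]
  refine Finset.sum_congr rfl fun j _ => Finset.sum_congr rfl fun i _ => ?_
  rw [Complex.sq_norm, Complex.normSq_apply]
  simp

theorem trace_sq_le {k : ℕ} (X : Matrix (Fin k) (Fin k) ℂ) :
    (Matrix.trace X).re ^ 2 ≤ k * (Matrix.trace (Xᴴ * X)).re := by
  rw [trace_conj_mul_re]
  have h1 : (Matrix.trace X).re = ∑ j, (X j j).re := by
    simp [Matrix.trace]
  rw [h1]
  have h2 := sq_sum_le_card_mul_sum_sq (s := (Finset.univ : Finset (Fin k)))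
    (f := fun j => (X j j).re)
  rw [Finset.card_univ, Fintype.card_fin] at h2
  refine h2.trans ?_
  gcongr with j
  have h3 : (X j j).re ^ 2 ≤ ‖X j j‖ ^ 2 := by
    rw [← sq_abs]
    gcongr
    exact Complex.abs_re_le_norm _
  refine h3.trans (Finset.single_le_sum (f := fun i => ‖X i j‖ ^ 2)
    (fun i _ => by positivity) (Finset.mem_univ j))

theorem trace_re_le {k : ℕ} (X : Matrix (Fin k) (Fin k) ℂ) :
    (Matrix.trace X).re ≤ k * ‖X‖ := by
  have h1 : (Matrix.trace X).re = ∑ j, (X j j).re := by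
    simp [Matrix.trace]
  rw [h1]
  refine (Finset.sum_le_card_nsmul _ _ ‖X‖ fun j _ => ?_).trans (by simp)
  exact (Complex.re_le_norm _).trans (entry_norm_le_l2 X j j)

section Tr

variable {𝒜 : Type*} [NormedRing 𝒜] [StarRing 𝒜] [CStarRing 𝒜] [CompleteSpace 𝒜]
  [NormedAlgebra ℂ 𝒜] [StarModule ℂ 𝒜]

theorem tr_star {tr : 𝒜 →ₗ[ℂ] ℂ} (htr : IsTracialStateA tr) (x : 𝒜) :
    tr (star x) = starRingEnd ℂ (tr x) := by
  obtain ⟨h1, hp, -⟩ := htr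
  have hx := (Complex.nonneg_iff.mp (hp x)).2
  have ha := (Complex.nonneg_iff.mp (hp (1 + x))).2
  have hb := (Complex.nonneg_iff.mp (hp (Complex.I • 1 + x))).2
  simp only [star_add, star_one, star_smul, add_mul, mul_add, one_mul, mul_one, map_add, h1,
    smul_mul_assoc, mul_smul_comm, map_smul, Complex.add_im, smul_eq_mul] at ha hb
  simp [Complex.mul_im] at ha hb
  apply Complex.ext
  · simp; linarith
  · simp; linarith

theorem tr_bessel {tr : 𝒜 →ₗ[ℂ] ℂ} (htr : IsTracialStateA tr) (p x : 𝒜)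
    (hpp : tr (star p * p) = 1) (hxx : (tr (star x * x)).re ≤ 1) : ‖tr (star p * x)‖ ≤ 1 := by
  set c := tr (star p * x) with hc
  have h1 : tr (star x * p) = starRingEnd ℂ c := by
    rw [hc, ← tr_star htr, star_mul, star_star]
  have h2 := (Complex.nonneg_iff.mp (htr.2.1 (x - c • p))).1
  simp only [star_sub, star_smul, sub_mul, mul_sub, smul_mul_assoc, mul_smul_comm, map_sub,
    map_smul, h1, hpp, ← hc, smul_eq_mul] at h2
  simp at h2
  have h3 : ‖c‖ ^ 2 ≤ 1 := by
    rw [Complex.sq_norm, Complex.normSq_apply]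
    linarith
  nlinarith [norm_nonneg c]

end Tr

end Helpers

section Main

variable {𝒜 : Type*} [NormedRing 𝒜] [StarRing 𝒜] [CStarRing 𝒜] [CompleteSpace 𝒜]
  [NormedAlgebra ℂ 𝒜] [StarModule ℂ 𝒜]

theorem matPolyEvalA_apply {n d k : ℕ} (a : Fin n → 𝒜)
    (e : WordLE n d → Matrix (Fin k) (Fin k) ℂ) (i j : Fin k) :
    matPolyEvalA a e i j = ∑ w : WordLE n d, e w i j • wordEvalA a w.1 := by
  unfold matPolyEvalA
  simp [Matrix.sum_apply]

theorem gEval_orth {tr : 𝒜 →ₗ[ℂ] ℂ} {n : ℕ} {a : Fin n → 𝒜} (ha : ∀ i, IsSelfAdjoint (a i))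
    {τ : NCPoly n →ₗ[ℂ] ℂ} (hlaw : ∀ f : NCPoly n, τ f = tr (polyEvalA a f))
    {d : ℕ} {P : Word n → NCPoly n} (hONB : IsONB τ d P) (v w : WordLE n d) :
    tr (star (gEval a (P v.1)) * gEval a (P w.1)) = if v = w then 1 else 0 := by
  have h := hONB.2.2.1 v.1 w.1 v.2 w.2
  rw [hlaw, polyEvalA_eq, map_mul, gEval_ncStar a (fun i => (ha i).star_eq)] at h
  rw [h]
  simp [Subtype.ext_iff]

/-- The entries of the coefficients of an admissible polynomial are bounded. -/
theorem coeff_bound {tr : 𝒜 →ₗ[ℂ] ℂ} (htr : IsTracialStateA tr)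
    {n : ℕ} {a : Fin n → 𝒜} (ha : ∀ i, IsSelfAdjoint (a i))
    {τ : NCPoly n →ₗ[ℂ] ℂ} (hlaw : ∀ f : NCPoly n, τ f = tr (polyEvalA a f))
    {d : ℕ} {P : Word n → NCPoly n} (hONB : IsONB τ d P) (k : ℕ) :
    ∃ C : ℝ, ∀ e : WordLE n d → Matrix (Fin k) (Fin k) ℂ,
      cstarNormSqLE (matPolyEvalA a e) 1 → ∀ w i j, ‖e w i j‖ ≤ C := by
  classical
  let S : Matrix (WordLE n d) (WordLE n d) ℂ := fun w v => (P v.1).coeff w.1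
  let T : Matrix (WordLE n d) (WordLE n d) ℂ :=
    fun v w => tr (star (gEval a (P v.1)) * wordEvalA a w.1)
  have hTS : T * S = 1 := by
    ext v u
    rw [Matrix.mul_apply, Matrix.one_apply, ← gEval_orth ha hlaw hONB v u,
      gEval_expand a (hONB.1 u.1 u.2), Finset.mul_sum, map_sum]
    refine Finset.sum_congr rfl fun w _ => ?_
    simp only [T, S, mul_smul_comm, map_smul, smul_eq_mul, wordEvalA]
    ring
  have hST : S * T = 1 := mul_eq_one_comm.mp hTS
  refine ⟨∑ w, ∑ v, ‖S w v‖, fun e he w i j => ?_⟩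
  have hX : (tr (star (matPolyEvalA a e i j) * matPolyEvalA a e i j)).re ≤ 1 := by
    obtain ⟨Q, hQ⟩ := he
    have h := congrArg (fun Y : Matrix (Fin k) (Fin k) 𝒜 => (tr (Y j j)).re) hQ
    simp only [Complex.ofReal_one, one_smul, Matrix.sub_apply, Matrix.one_apply_eq,
      Matrix.mul_apply, Matrix.conjTranspose_apply, map_sub, map_sum, htr.1, Complex.sub_re,
      Complex.one_re, Complex.re_sum] at h
    have h1 : 0 ≤ ∑ l, (tr (star (Q l j) * Q l j)).re :=
      Finset.sum_nonneg fun l _ => (Complex.nonneg_iff.mp (htr.2.1 _)).1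
    have h2 := Finset.single_le_sum (s := Finset.univ)
      (f := fun l => (tr (star (matPolyEvalA a e l j) * matPolyEvalA a e l j)).re)
      (fun l _ => (Complex.nonneg_iff.mp (htr.2.1 _)).1) (Finset.mem_univ i)
    linarith
  have hT : ∀ v, ‖(T *ᵥ fun w => e w i j) v‖ ≤ 1 := by
    intro v
    have h1 := tr_bessel htr (gEval a (P v.1)) (matPolyEvalA a e i j)
      (by simpa using gEval_orth ha hlaw hONB v v) hX
    convert h1 using 2
    rw [matPolyEvalA_apply, Finset.mul_sum, map_sum]
    simp only [Matrix.mulVec, dotProduct, T, mul_smul_comm, map_smul, smul_eq_mul]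
    exact Finset.sum_congr rfl fun _ _ => mul_comm _ _
  have he : e w i j = (S *ᵥ (T *ᵥ fun w => e w i j)) w := by
    rw [Matrix.mulVec_mulVec, hST, Matrix.one_mulVec]
  rw [he]
  calc ‖(S *ᵥ (T *ᵥ fun w => e w i j)) w‖ ≤ ∑ v, ‖S w v * (T *ᵥ fun w => e w i j) v‖ :=
        norm_sum_le _ _
    _ ≤ ∑ v, ‖S w v‖ := by
        refine Finset.sum_le_sum fun v _ => ?_
        rw [norm_mul]
        exact mul_le_of_le_one_right (norm_nonneg _) (hT v)
    _ ≤ _ := Finset.single_le_sum (f := fun w => ∑ v, ‖S w v‖)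
        (fun w _ => Finset.sum_nonneg fun _ _ => norm_nonneg _) (Finset.mem_univ w)

theorem bdd_of_continuous {tr : 𝒜 →ₗ[ℂ] ℂ} (htr : IsTracialStateA tr)
    {n : ℕ} {a : Fin n → 𝒜} (ha : ∀ i, IsSelfAdjoint (a i))
    {τ : NCPoly n →ₗ[ℂ] ℂ} (hlaw : ∀ f : NCPoly n, τ f = tr (polyEvalA a f))
    {d : ℕ} {P : Word n → NCPoly n} (hONB : IsONB τ d P) (k : ℕ)
    (A : Fin n → Matrix (Fin k) (Fin k) ℂ)
    (F : Matrix (Fin k) (Fin k) ℂ → ℝ) (hF : Continuous F) :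
    BddAbove { t : ℝ | ∃ e : WordLE n d → Matrix (Fin k) (Fin k) ℂ,
      cstarNormSqLE (matPolyEvalA a e) 1 ∧ t = F (matPolyEvalM A e) } := by
  obtain ⟨C, hC⟩ := coeff_bound htr ha hlaw hONB k
  have hK : IsCompact (Set.univ.pi fun _ : WordLE n d => Set.univ.pi fun _ : Fin k =>
      Set.univ.pi fun _ : Fin k => Metric.closedBall (0 : ℂ) C) :=
    isCompact_univ_pi fun _ => isCompact_univ_pi fun _ => isCompact_univ_pi fun _ =>
      isCompact_closedBall _ _
  have hcont : Continuous fun e : WordLE n d → Matrix (Fin k) (Fin k) ℂ =>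
      F (matPolyEvalM A e) := by
    refine hF.comp ?_
    unfold matPolyEvalM
    exact continuous_finset_sum _ fun w _ => (continuous_apply w).matrix_mul continuous_const
  refine (hK.bddAbove_image (f := fun e : WordLE n d → Matrix (Fin k) (Fin k) ℂ =>
      F (matPolyEvalM A e)) hcont.continuousOn).mono ?_
  rintro t ⟨e, he, rfl⟩
  refine ⟨e, ?_, rfl⟩
  intro w _ i _ j _
  simpa using hC e he w i j

/-- The coefficients of `Σ_v P_v(A) ⊗ P_v⋆`. -/
noncomputable def extremal {n k : ℕ} (d : ℕ) (P : Word n → NCPoly n)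
    (A : Fin n → Matrix (Fin k) (Fin k) ℂ) (w : WordLE n d) : Matrix (Fin k) (Fin k) ℂ :=
  ∑ v : WordLE n d, (ncStar (P v.1)).coeff w.1 • polyEvalM A (P v.1)

theorem extremal_evalM {n k d : ℕ} {P : Word n → NCPoly n}
    (hP : ∀ w : Word n, wlen w ≤ d → P w ∈ degLE n d) (A : Fin n → Matrix (Fin k) (Fin k) ℂ) :
    matPolyEvalM A (extremal d P A) = cdKernel d P A := by
  unfold matPolyEvalM extremal cdKernel
  simp only [Finset.sum_mul]
  rw [Finset.sum_comm]
  refine Finset.sum_congr rfl fun v _ => ?_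
  rw [polyEvalM_eq A (ncStar _), gEval_expand A (ncStar_mem_degLE (hP v.1 v.2)), Finset.mul_sum]
  refine Finset.sum_congr rfl fun w _ => ?_
  rw [smul_mul_assoc, mul_smul_comm]
  rfl

theorem extremal_evalA {n k d : ℕ} {a : Fin n → 𝒜} (ha : ∀ i, IsSelfAdjoint (a i))
    {P : Word n → NCPoly n}
    (hP : ∀ w : Word n, wlen w ≤ d → P w ∈ degLE n d) (A : Fin n → Matrix (Fin k) (Fin k) ℂ)
    (i j : Fin k) :
    matPolyEvalA a (extremal d P A) i j =
      ∑ v : WordLE n d, polyEvalM A (P v.1) i j • star (gEval a (P v.1)) := by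
  rw [matPolyEvalA_apply]
  unfold extremal
  simp only [Matrix.sum_apply, Finset.sum_smul]
  rw [Finset.sum_comm]
  refine Finset.sum_congr rfl fun v _ => ?_
  rw [← gEval_ncStar a (fun i => (ha i).star_eq),
    gEval_expand a (ncStar_mem_degLE (hP v.1 v.2)), Finset.smul_sum]
  refine Finset.sum_congr rfl fun w _ => ?_
  rw [Matrix.smul_apply, smul_eq_mul, smul_smul, mul_comm]
  rfl

theorem trace_cdKernel {n k d : ℕ} {P : Word n → NCPoly n} {A : Fin n → Matrix (Fin k) (Fin k) ℂ}
    (hA : ∀ i, (A i).IsHermitian) :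
    (Matrix.trace (cdKernel d P A)) =
      ((∑ v : WordLE n d, ∑ i, ∑ j, ‖polyEvalM A (P v.1) i j‖ ^ 2 : ℝ) : ℂ) := by
  unfold cdKernel
  rw [Matrix.trace_sum]
  push_cast
  refine Finset.sum_congr rfl fun v _ => ?_
  rw [polyEvalM_eq A (ncStar _), gEval_ncStar A (fun i => (hA i).eq), ← polyEvalM_eq]
  simp only [Matrix.trace, Matrix.diag, Matrix.mul_apply, Matrix.star_apply]
  refine Finset.sum_congr rfl fun i _ => Finset.sum_congr rfl fun j _ => ?_
  exact Complex.mul_conj' _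

theorem trace_extremal {tr : 𝒜 →ₗ[ℂ] ℂ} (htr : IsTracialStateA tr)
    {n : ℕ} {a : Fin n → 𝒜} (ha : ∀ i, IsSelfAdjoint (a i))
    {τ : NCPoly n →ₗ[ℂ] ℂ} (hlaw : ∀ f : NCPoly n, τ f = tr (polyEvalA a f))
    {d : ℕ} {P : Word n → NCPoly n} (hONB : IsONB τ d P) {k : ℕ}
    {A : Fin n → Matrix (Fin k) (Fin k) ℂ} (hA : ∀ i, (A i).IsHermitian) :
    ∑ i : Fin k, tr (((matPolyEvalA a (extremal d P A))ᴴ * matPolyEvalA a (extremal d P A)) i i)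
      = Matrix.trace (cdKernel d P A) := by
  rw [trace_cdKernel hA]
  have key : ∀ i j, tr (star (matPolyEvalA a (extremal d P A) i j) *
      matPolyEvalA a (extremal d P A) i j) =
      ∑ v : WordLE n d, ((‖polyEvalM A (P v.1) i j‖ : ℂ)) ^ 2 := by
    intro i j
    rw [extremal_evalA ha hONB.1, star_sum, Finset.sum_mul, map_sum]
    refine Finset.sum_congr rfl fun v _ => ?_
    rw [Finset.mul_sum, map_sum, Finset.sum_eq_single v]
    · rw [star_smul, star_star, smul_mul_assoc, mul_smul_comm, map_smul, map_smul, htr.2.2,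
        gEval_orth ha hlaw hONB, if_pos rfl]
      simp only [smul_eq_mul, mul_one]
      exact Complex.conj_mul' _
    · intro w _ hw
      rw [star_smul, star_star, smul_mul_assoc, mul_smul_comm, map_smul, map_smul, htr.2.2,
        gEval_orth ha hlaw hONB, if_neg hw]
      simp
    · simp
  simp only [Matrix.mul_apply, Matrix.conjTranspose_apply, map_sum, key]
  push_cast
  rw [Finset.sum_comm]
  conv_rhs => rw [Finset.sum_comm]
  refine Finset.sum_congr rfl fun i _ => ?_
  rw [Finset.sum_comm]

theorem trace_cdKernel_pos {n k d : ℕ} (hk : 1 ≤ k) {P : Word n → NCPoly n} (hP : P 1 = 1)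
    {A : Fin n → Matrix (Fin k) (Fin k) ℂ} (hA : ∀ i, (A i).IsHermitian) :
    0 < (Matrix.trace (cdKernel d P A)).re := by
  rw [trace_cdKernel hA, Complex.ofReal_re]
  refine Finset.sum_pos' (fun v _ => by positivity)
    ⟨(⟨1, by simp [wlen]⟩ : WordLE n d), Finset.mem_univ _, ?_⟩
  refine Finset.sum_pos' (fun v _ => by positivity) ⟨⟨0, hk⟩, Finset.mem_univ _, ?_⟩
  refine Finset.sum_pos' (fun v _ => by positivity) ⟨⟨0, hk⟩, Finset.mem_univ _, ?_⟩
  simp [hP, polyEvalM_eq]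

end Main

/-- If the joint law `τ` of `a` is faithful, `(P_w)` is a family of
orthonormal polynomials of `τ` at degree `d`, and `M_d ∈ [1,∞)` satisfies the degree-`d`
Bernstein–Markov inequality `‖P(a)‖ ≤ M_d ((tr_k⊗tr)(P(a)⋆P(a)))^{1/2}` for all
`P ∈ M_k(ℂ⟨X⟩_d)`, then for every tuple `A` of hermitian `k×k` matrices:
`‖κ_{τ,d}(A,A)(I_k)‖ ≤ M_d² Φ^∞_{a,d}(A)` and `tr_k(κ_{τ,d}(A,A)(I_k)) ≤ M_d² Φ²_{a,d}(A)`. -/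
theorem cdKernel_le_siciak_of_bernstein_markov {𝒜 : Type*} [NormedRing 𝒜] [StarRing 𝒜]
    [CStarRing 𝒜] [CompleteSpace 𝒜] [NormedAlgebra ℂ 𝒜] [StarModule ℂ 𝒜]
    (tr : 𝒜 →ₗ[ℂ] ℂ) (htr : IsTracialStateA tr) (hfaith : IsFaithfulA tr)
    {n : ℕ} (a : Fin n → 𝒜) (ha : ∀ i, IsSelfAdjoint (a i))
    (τ : NCPoly n →ₗ[ℂ] ℂ) (hlaw : ∀ f : NCPoly n, τ f = tr (polyEvalA a f))
    (hτfaith : IsFaithful τ)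
    (d : ℕ) (P : Word n → NCPoly n) (hONB : IsONB τ d P)
    (k : ℕ) (hk : 1 ≤ k) (M : ℝ) (hM : 1 ≤ M)
    (hBM : ∀ e : WordLE n d → Matrix (Fin k) (Fin k) ℂ,
      cstarNormSqLE (matPolyEvalA a e) (M ^ 2 *
        ((∑ i : Fin k, tr (((matPolyEvalA a e)ᴴ * matPolyEvalA a e) i i)) / k).re))
    (A : Fin n → Matrix (Fin k) (Fin k) ℂ) (hA : ∀ i, (A i).IsHermitian) :
    ‖cdKernel d P A‖ ≤ M ^ 2 * PhiInf a d k A ∧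
    (Matrix.trace (cdKernel d P A)).re / k ≤ M ^ 2 * Phi2 a d k A := by
  set κ := cdKernel d P A with hκ
  set s : ℝ := (Matrix.trace κ).re / k with hs
  have hk0 : (0 : ℝ) < k := by exact_mod_cast hk
  have hM0 : 0 < M := by linarith
  have hs0 : 0 < s := div_pos (trace_cdKernel_pos hk hONB.2.1 hA) hk0
  have hB := hBM (extremal d P A)
  rw [trace_extremal htr ha hlaw hONB hA, ← hκ, Complex.div_natCast_re, ← hs] at hB
  have hc0 : 0 < M ^ 2 * s := by positivity
  set t : ℝ := (Real.sqrt (M ^ 2 * s))⁻¹ with ht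
  have ht2 : t ^ 2 = (M ^ 2 * s)⁻¹ := by
    rw [ht, inv_pow, Real.sq_sqrt hc0.le]
  have hB1 := cstarNormSqLE_smul _ _ t hB
  rw [ht2, inv_mul_cancel₀ hc0.ne'] at hB1
  have hev : matPolyEvalA a (fun w => (t : ℂ) • extremal d P A w) =
      (t : ℂ) • matPolyEvalA a (extremal d P A) := by
    ext i j
    rw [Matrix.smul_apply, matPolyEvalA_apply, matPolyEvalA_apply, Finset.smul_sum]
    refine Finset.sum_congr rfl fun w _ => ?_
    rw [Matrix.smul_apply, smul_assoc]
  have hevM : matPolyEvalM A (fun w => (t : ℂ) • extremal d P A w) = (t : ℂ) • κ := by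
    rw [hκ, ← extremal_evalM hONB.1 A]
    unfold matPolyEvalM
    rw [Finset.smul_sum]
    refine Finset.sum_congr rfl fun w _ => ?_
    rw [smul_mul_assoc]
  rw [← hev] at hB1
  constructor
  · have hle : ‖(t : ℂ) • κ‖ ^ 2 ≤ PhiInf a d k A :=
      le_csSup (bdd_of_continuous htr ha hlaw hONB k A (fun X => ‖X‖ ^ 2)
        (continuous_norm.pow 2)) ⟨_, hB1, by rw [hevM]⟩
    rw [norm_smul, mul_pow, Complex.norm_real, Real.norm_eq_abs, sq_abs, ht2] at hle
    have hsκ : s ≤ ‖κ‖ := by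
      rw [hs, div_le_iff₀ hk0, mul_comm]
      exact trace_re_le κ
    have h1 : ‖κ‖ ≤ M ^ 2 * ((M ^ 2 * s)⁻¹ * ‖κ‖ ^ 2) := by
      have : M ^ 2 * ((M ^ 2 * s)⁻¹ * ‖κ‖ ^ 2) = ‖κ‖ ^ 2 / s := by
        field_simp
      rw [this, le_div_iff₀ hs0, sq]
      exact mul_le_mul_of_nonneg_left hsκ (norm_nonneg _)
    exact h1.trans (mul_le_mul_of_nonneg_left hle (by positivity))
  · have hle : (Matrix.trace (((t : ℂ) • κ)ᴴ * ((t : ℂ) • κ))).re / k ≤ Phi2 a d k A :=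
      le_csSup (bdd_of_continuous htr ha hlaw hONB k A
        (fun X => (Matrix.trace (Xᴴ * X)).re / k) (by fun_prop)) ⟨_, hB1, by rw [hevM]⟩
    have h0 : (Matrix.trace (((t : ℂ) • κ)ᴴ * ((t : ℂ) • κ))).re =
        t ^ 2 * (Matrix.trace (κᴴ * κ)).re := by
      simp only [trace_conj_mul_re, Matrix.smul_apply, norm_smul, mul_pow, Complex.norm_real,
        Real.norm_eq_abs, sq_abs, Finset.mul_sum]
    rw [h0, ht2] at hle
    have h2 := trace_sq_le κ
    have h1 : s ≤ M ^ 2 * ((M ^ 2 * s)⁻¹ * (Matrix.trace (κᴴ * κ)).re / k) := by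
      have : M ^ 2 * ((M ^ 2 * s)⁻¹ * (Matrix.trace (κᴴ * κ)).re / k) =
          ((Matrix.trace (κᴴ * κ)).re / k) / s := by
        field_simp
      rw [this, le_div_iff₀ hs0, le_div_iff₀ hk0]
      have h3 : (Matrix.trace κ).re = s * k := by
        rw [hs]; field_simp
      rw [h3] at h2
      have h4 : k * (s * s * k) ≤ k * (Matrix.trace (κᴴ * κ)).re := by
        calc k * (s * s * k) = (s * k) ^ 2 := by ring
          _ ≤ _ := h2
      exact le_of_mul_le_mul_left h4 hk0
    exact h1.trans (mul_le_mul_of_nonneg_left hle (by positivity))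

end NCCD
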